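/- Let R be a Noetherian local integral domain of dimension d > 0 with maximal ideal m, M ⊆ m·R^m a submodule such that R^m/M has finite length, and U = R[y₁,…,y_n] ⊆ R[x₁,…,x_m] the subalgebra generated by the linear forms corresponding to generators of M. Then dim U = d + m. -/

import Mathlib

open MvPolynomial IsLocalRing

section DimensionBounds

variable {R S : Type*} [CommRing R] [CommRing S] [IsDomain S] [Algebra R S]

/-- Adjoining an algebraic element to a Noetherian subalgebra of a domain preserves
Noetherianity and does not increase the Krull dimension. -/
theorem ringKrullDim_sup_adjoin_singleton_le (W : Subalgebra R S) (hW : IsNoetherianRing W)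
    {t : S} (ht : IsAlgebraic W t) :
    IsNoetherianRing ↥(W ⊔ Algebra.adjoin R {t}) ∧
      ringKrullDim ↥(W ⊔ Algebra.adjoin R {t}) ≤ ringKrullDim W := by
  let f : Polynomial W →ₐ[R] S := (Polynomial.aeval (R := W) t).restrictScalars R
  have hrange : f.range = W ⊔ Algebra.adjoin R {t} := by
    apply le_antisymm
    · rintro _ ⟨p, rfl⟩
      change Polynomial.aeval t p ∈ _
      induction p using Polynomial.induction_on' with
      | add p q hp hq => rw [map_add]; exact add_mem hp hq
      | monomial k a =>
        rw [Polynomial.aeval_monomial]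
        exact mul_mem ((le_sup_left : W ≤ _) a.2)
          (pow_mem ((le_sup_right : Algebra.adjoin R {t} ≤ W ⊔ _)
            (Algebra.subset_adjoin rfl)) _)
    · refine sup_le (fun w hw => ⟨Polynomial.C ⟨w, hw⟩, ?_⟩)
        (Algebra.adjoin_le (Set.singleton_subset_iff.2 ⟨Polynomial.X, ?_⟩))
      · exact Polynomial.aeval_C (R := W) t ⟨w, hw⟩
      · exact Polynomial.aeval_X (R := W) t
  rw [← hrange]
  have hsurj := f.rangeRestrict_surjective
  refine ⟨isNoetherianRing_of_surjective _ _ f.rangeRestrict.toRingHom hsurj, ?_⟩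
  obtain ⟨p, hp, hpt⟩ := ht
  have h := ringKrullDim_succ_le_of_surjective f.rangeRestrict.toRingHom hsurj
    (mem_nonZeroDivisors_of_ne_zero hp) (Subtype.ext hpt)
  rw [Polynomial.ringKrullDim_of_isNoetherianRing] at h
  exact ENat.WithBot.add_le_add_one_right_iff.1 h

/-- Adjoining finitely many algebraic elements to a Noetherian subalgebra of a domain does not
increase the Krull dimension. -/
theorem ringKrullDim_sup_adjoin_finset_le (V : Subalgebra R S) (hV : IsNoetherianRing V)
    (T : Finset S) (hT : ∀ t ∈ T, IsAlgebraic V t) :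
    IsNoetherianRing ↥(V ⊔ Algebra.adjoin R (T : Set S)) ∧
      ringKrullDim ↥(V ⊔ Algebra.adjoin R (T : Set S)) ≤ ringKrullDim V := by
  classical
  induction T using Finset.induction_on with
  | empty =>
    rw [Finset.coe_empty, Algebra.adjoin_empty, sup_bot_eq]
    exact ⟨hV, le_rfl⟩
  | insert t T _ ih =>
    obtain ⟨hN, hdim⟩ := ih fun s hs => hT s (Finset.mem_insert_of_mem hs)
    have ht : IsAlgebraic ↥(V ⊔ Algebra.adjoin R (T : Set S)) t := by
      obtain ⟨p, hp, hpt⟩ := hT t (Finset.mem_insert_self _ _)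
      have hle : V ≤ V ⊔ Algebra.adjoin R (T : Set S) := le_sup_left
      refine ⟨p.map (Subalgebra.inclusion hle).toRingHom, ?_, ?_⟩
      · exact (Polynomial.map_ne_zero_iff (Subalgebra.inclusion_injective hle)).2 hp
      · rw [Polynomial.aeval_def, Polynomial.eval₂_map]
        exact hpt
    obtain ⟨hN', hdim'⟩ := ringKrullDim_sup_adjoin_singleton_le _ hN ht
    have heq : V ⊔ Algebra.adjoin R ((insert t T : Finset S) : Set S) =
        V ⊔ Algebra.adjoin R (T : Set S) ⊔ Algebra.adjoin R {t} := by
      rw [Finset.coe_insert, Set.insert_eq, Set.union_comm, Algebra.adjoin_union, sup_assoc]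
    rw [heq]
    exact ⟨hN', hdim'.trans hdim⟩

end DimensionBounds

/-- If a quotient of a finite free module over a positive-dimensional domain has finite length,
then a single nonzero scalar annihilates the classes of all basis vectors. -/
theorem exists_ne_zero_smul_single_mem {R : Type*} [CommRing R] [IsDomain R]
    (hd : 0 < ringKrullDim R) {m : ℕ} (M : Submodule R (Fin m → R))
    (hM : IsFiniteLength R ((Fin m → R) ⧸ M)) :
    ∃ c : R, c ≠ 0 ∧ ∀ i, c • (Pi.single i 1 : Fin m → R) ∈ M := by
  have key (v : Fin m → R) : ∃ c : R, c ≠ 0 ∧ c • v ∈ M := by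
    by_contra! hcon
    have hinj : Function.Injective (LinearMap.toSpanSingleton R _ (M.mkQ v)) := by
      rw [injective_iff_map_eq_zero]
      intro r hr
      by_contra hr0
      apply hcon r hr0
      rwa [LinearMap.toSpanSingleton_apply, ← map_smul, Submodule.mkQ_apply,
        Submodule.Quotient.mk_eq_zero] at hr
    have : IsArtinian R ((Fin m → R) ⧸ M) := (isFiniteLength_iff_isNoetherian_isArtinian.1 hM).2
    have : IsArtinianRing R := isArtinian_of_injective _ hinj
    exact hd.ne' (ringKrullDim_eq_zero_of_isField (IsArtinianRing.isField_of_isDomain R))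
  choose c hc0 hc using fun i => key (Pi.single i 1)
  refine ⟨∏ i, c i, Finset.prod_ne_zero_iff.2 fun i _ => hc0 i, fun i => ?_⟩
  rw [← Finset.prod_erase_mul _ _ (Finset.mem_univ i), mul_smul]
  exact M.smul_mem _ (hc i)

section MvPolynomialSubalgebra

variable {R : Type*} [CommRing R] {m : ℕ}

/-- The endomorphism of the polynomial ring setting the first `k` variables to zero. -/
noncomputable def killVariables (R : Type*) [CommRing R] (m k : ℕ) :
    MvPolynomial (Fin m) R →ₐ[R] MvPolynomial (Fin m) R :=
  aeval fun i => if (i : ℕ) < k then 0 else X i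

theorem killVariables_X (k : ℕ) (i : Fin m) :
    killVariables R m k (X i) = if (i : ℕ) < k then 0 else X i :=
  aeval_X _ _

theorem killVariables_succ_comp (k : ℕ) :
    (killVariables R m (k + 1)).comp (killVariables R m k) = killVariables R m (k + 1) := by
  ext1 i
  rw [AlgHom.comp_apply, killVariables_X, killVariables_X]
  split_ifs with h h' h'
  · rw [map_zero]
  · omega
  · rw [killVariables_X, if_pos h']
  · rw [killVariables_X, if_neg h']

/-- A subalgebra of a polynomial ring in `m` variables over a domain that contains a nonzero
multiple of each variable has dimension at least `m` more than the base. -/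
theorem ringKrullDim_add_le_of_smul_X_mem [IsDomain R]
    (U : Subalgebra R (MvPolynomial (Fin m) R)) {c : R} (hc0 : c ≠ 0) (hc : ∀ i, c • (X i : MvPolynomial (Fin m) R) ∈ U) :
    ringKrullDim R + (m : ℕ) ≤ ringKrullDim U := by
  have step (k : ℕ) (hk : k < m) :
      ringKrullDim (U.map (killVariables R m (k + 1))) + 1 ≤
        ringKrullDim (U.map (killVariables R m k)) := by
    let g : U.map (killVariables R m k) →ₐ[R] U.map (killVariables R m (k + 1)) :=
      ((killVariables R m (k + 1)).comp (Subalgebra.val _)).codRestrict _ (by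
        rintro ⟨_, u, hu, rfl⟩
        exact ⟨u, hu, (DFunLike.congr_fun (killVariables_succ_comp k) u).symm⟩)
    have hg : Function.Surjective g := by
      rintro ⟨_, u, hu, rfl⟩
      exact ⟨⟨_, u, hu, rfl⟩, Subtype.ext (DFunLike.congr_fun (killVariables_succ_comp k) u)⟩
    have hx : c • (X ⟨k, hk⟩ : MvPolynomial (Fin m) R) ∈ U.map (killVariables R m k) :=
      ⟨_, hc ⟨k, hk⟩, by
        change killVariables R m k _ = _
        rw [map_smul, killVariables_X, if_neg (lt_irrefl k)]⟩
    have hzero : killVariables R m (k + 1) (c • (X ⟨k, hk⟩ : MvPolynomial (Fin m) R)) = 0 := by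
      rw [map_smul, killVariables_X, if_pos (Nat.lt_succ_self k), smul_zero]
    refine ringKrullDim_succ_le_of_surjective g.toRingHom hg (r := ⟨_, hx⟩)
      (mem_nonZeroDivisors_of_ne_zero ?_) (Subtype.ext ?_)
    · exact fun h => smul_ne_zero hc0 (X_ne_zero _) (congrArg Subtype.val h)
    · exact hzero
  have chain (k : ℕ) (hk : k ≤ m) :
      ringKrullDim (U.map (killVariables R m k)) + (k : ℕ) ≤ ringKrullDim U := by
    induction k with
    | zero =>
      have h : killVariables R m 0 = AlgHom.id R _ := by
        ext1 i
        simp [killVariables_X]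
      rw [h, Subalgebra.map_id, Nat.cast_zero, add_zero]
    | succ k ih =>
      refine le_trans ?_ (ih (by omega))
      rw [Nat.cast_succ, add_comm (k : WithBot ℕ∞), ← add_assoc]
      gcongr
      exact step k hk
  refine le_trans ?_ (chain m le_rfl)
  gcongr
  refine ringKrullDim_le_of_surjective
    ((constantCoeff (σ := Fin m) (R := R)).comp (U.map (killVariables R m m)).val.toRingHom)
    fun r => ⟨algebraMap R _ r, constantCoeff_C _ r⟩

/-- An algebra generated by linear forms in `m` variables over a Noetherian domain that contains
a nonzero multiple of each variable has dimension at most `m` more than the base. -/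
theorem ringKrullDim_adjoin_le_of_smul_X_mem [IsDomain R] [IsNoetherianRing R] {n : ℕ}
    (A : Fin m → Fin n → R) {c : R} (hc0 : c ≠ 0)
    (hc : ∀ i, c • (X i : MvPolynomial (Fin m) R) ∈ Algebra.adjoin R
      (Set.range fun j : Fin n => ∑ i : Fin m, A i j • (X i : MvPolynomial (Fin m) R))) :
    ringKrullDim (Algebra.adjoin R
      (Set.range fun j : Fin n => ∑ i : Fin m, A i j • (X i : MvPolynomial (Fin m) R))) ≤
        ringKrullDim R + (m : ℕ) := by
  classical
  set y : Fin n → MvPolynomial (Fin m) R := fun j => ∑ i, A i j • X i with hy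
  let f : MvPolynomial (Fin m) R →ₐ[R] MvPolynomial (Fin m) R := aeval fun i => c • X i
  have hX (i : Fin m) : c • (X i : MvPolynomial (Fin m) R) ∈ f.range := ⟨X i, aeval_X _ _⟩
  have hsurj := f.rangeRestrict_surjective
  have hN : IsNoetherianRing f.range :=
    isNoetherianRing_of_surjective _ _ f.rangeRestrict.toRingHom hsurj
  have hdim : ringKrullDim f.range ≤ ringKrullDim R + (m : ℕ) := by
    refine (ringKrullDim_le_of_surjective f.rangeRestrict.toRingHom hsurj).trans_eq ?_
    rw [MvPolynomial.ringKrullDim_of_isNoetherianRing, Nat.card_fin]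
  have hcy (j : Fin n) : c • y j ∈ f.range := by
    rw [hy, Finset.smul_sum]
    refine sum_mem fun i _ => ?_
    rw [smul_comm]
    exact Subalgebra.smul_mem _ (hX i) _
  have halg : ∀ t ∈ Finset.univ.image y, IsAlgebraic f.range t := by
    intro t ht
    obtain ⟨j, -, rfl⟩ := Finset.mem_image.1 ht
    refine ⟨Polynomial.C (algebraMap R f.range c) * Polynomial.X - Polynomial.C ⟨_, hcy j⟩,
      fun h => ?_, ?_⟩
    · have h1 := congrArg (fun p => (Polynomial.coeff p 1 : f.range)) h
      simp only [Polynomial.coeff_sub, Polynomial.coeff_C_mul, Polynomial.coeff_X_one, mul_one,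
        Polynomial.coeff_C_succ, sub_zero, Polynomial.coeff_zero] at h1
      exact hc0 (C_injective _ _ ((congrArg Subtype.val h1).trans (map_zero C).symm))
    · rw [map_sub, map_mul, Polynomial.aeval_C, Polynomial.aeval_X, Polynomial.aeval_C, sub_eq_zero]
      exact (Algebra.smul_def c (y j)).symm
  have h := (ringKrullDim_sup_adjoin_finset_le f.range hN _ halg).2
  have hle : f.range ≤ Algebra.adjoin R (Set.range y) := by
    rintro _ ⟨p, rfl⟩
    change aeval _ p ∈ _
    rw [aeval_def, eval₂_eq]
    exact sum_mem fun s _ => mul_mem (Subalgebra.algebraMap_mem _ _)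
      (prod_mem fun i _ => pow_mem (hc i) _)
  rw [Finset.coe_image, Finset.coe_univ, Set.image_univ, sup_eq_right.2 hle] at h
  exact h.trans hdim

end MvPolynomialSubalgebra

/-- The linear form of a vector in the column span of `A` lies in the algebra generated by the
linear forms of the columns. -/
theorem sum_smul_X_mem_adjoin {R : Type*} [CommRing R] {m n : ℕ} (A : Fin m → Fin n → R)
    {v : Fin m → R}
    (hv : v ∈ Submodule.span R (Set.range fun j : Fin n => fun i : Fin m => A i j)) :
    ∑ i, v i • (X i : MvPolynomial (Fin m) R) ∈ Algebra.adjoin R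
      (Set.range fun j : Fin n => ∑ i : Fin m, A i j • (X i : MvPolynomial (Fin m) R)) := by
  induction hv using Submodule.span_induction with
  | mem v hv =>
    obtain ⟨j, rfl⟩ := hv
    exact Algebra.subset_adjoin ⟨j, rfl⟩
  | zero => simp
  | add v w _ _ hv hw =>
    simp only [Pi.add_apply, add_smul, Finset.sum_add_distrib]
    exact add_mem hv hw
  | smul a v _ hv =>
    simp only [Pi.smul_apply, smul_assoc, ← Finset.smul_sum]
    exact Subalgebra.smul_mem _ hv a

/-- Let `R` be a Noetherian local domain of dimension `d > 0`, `M ⊆ m·R^m` a submodule with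
`R^m/M` of finite length, generated by columns `A_j`, and `U = R[y₁,…,y_n]` the subalgebra
of `R[x₁,…,x_m]` generated by the corresponding linear forms `y_j = ∑_i A_{ij} x_i`.
Then `dim U = d + m`. -/
theorem krullDim_linear_subalgebra {R : Type*} [CommRing R] [IsNoetherianRing R]
    [IsLocalRing R] [IsDomain R] (hd : 0 < ringKrullDim R)
    (m n : ℕ) (A : Fin m → Fin n → R)
    (hA : ∀ i j, A i j ∈ maximalIdeal R)
    (hM : IsFiniteLength R ((Fin m → R) ⧸
      Submodule.span R (Set.range fun j : Fin n => fun i : Fin m => A i j)))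
    (U : Subalgebra R (MvPolynomial (Fin m) R))
    (hU : U = Algebra.adjoin R
      (Set.range fun j : Fin n => ∑ i : Fin m, A i j • (X i : MvPolynomial (Fin m) R))) :
    ringKrullDim U = ringKrullDim R + (m : ℕ) := by
  subst hU
  obtain ⟨c, hc0, hc⟩ := exists_ne_zero_smul_single_mem hd _ hM
  have hX (i : Fin m) : c • (X i : MvPolynomial (Fin m) R) ∈ Algebra.adjoin R
      (Set.range fun j : Fin n => ∑ i : Fin m, A i j • (X i : MvPolynomial (Fin m) R)) := by
    have h := sum_smul_X_mem_adjoin A (hc i)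
    simpa [Pi.single_apply, ite_smul] using h
  exact le_antisymm (ringKrullDim_adjoin_le_of_smul_X_mem A hc0 hX)
    (ringKrullDim_add_le_of_smul_X_mem _ hc0 hX)
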